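/- arXiv:0910.5626 — 8 statements merged into one kernel-verified Lean document; each statement's English description precedes it below -/
import Mathlib

section
/- Under the standing assumptions on the conformally immersed spacelike surface f with unit normal n, conformal factor u, mean curvature H and Hopf coefficient ξ, and assuming moreover that U is connected: H is constant on U if and only if ξ is holomorphic on U, i.e. ξ_{z̄} = ½(ξ_x + i ξ_y) vanishes identically on U. -/
noncomputable section

/-- The Lorentz bilinear form on `ℝ⁴`: `⟨x,y⟩ = x₁y₁ + x₂y₂ + x₃y₃ − x₄y₄`. -/
def lor (x y : Fin 4 → ℝ) : ℝ := x 0 * y 0 + x 1 * y 1 + x 2 * y 2 - x 3 * y 3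

/-- The complex-bilinear extension of the Lorentz form to `ℂ⁴`. -/
def lorC (x y : Fin 4 → ℂ) : ℂ := x 0 * y 0 + x 1 * y 1 + x 2 * y 2 - x 3 * y 3

/-- The partial derivative `g_x` of `g : ℂ → ℝ⁴` (derivative in the direction `1`). -/
def pdx (f : ℂ → Fin 4 → ℝ) (p : ℂ) : Fin 4 → ℝ := fderiv ℝ f p 1

/-- The partial derivative `g_y` of `g : ℂ → ℝ⁴` (derivative in the direction `i`). -/
def pdy (f : ℂ → Fin 4 → ℝ) (p : ℂ) : Fin 4 → ℝ := fderiv ℝ f p Complex.I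

/-- `g_z = ½ (g_x − i g_y)` for a map `g : ℂ → ℝ⁴`. -/
def dz (f : ℂ → Fin 4 → ℝ) (p : ℂ) : Fin 4 → ℂ :=
  fun j => (1 / 2 : ℂ) * ((pdx f p j : ℂ) - Complex.I * (pdy f p j : ℂ))

/-- `g_{z̄} = ½ (g_x + i g_y)` for a map `g : ℂ → ℝ⁴`. -/
def dzbar (f : ℂ → Fin 4 → ℝ) (p : ℂ) : Fin 4 → ℂ :=
  fun j => (1 / 2 : ℂ) * ((pdx f p j : ℂ) + Complex.I * (pdy f p j : ℂ))

/-- `g_z` for a complex-valued map `g : ℂ → ℂ⁴`. -/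
def dzC (g : ℂ → Fin 4 → ℂ) (p : ℂ) : Fin 4 → ℂ :=
  fun j => (1 / 2 : ℂ) * (fderiv ℝ g p 1 j - Complex.I * fderiv ℝ g p Complex.I j)

/-- `g_{z̄}` for a complex-valued map `g : ℂ → ℂ⁴`. -/
def dzbarC (g : ℂ → Fin 4 → ℂ) (p : ℂ) : Fin 4 → ℂ :=
  fun j => (1 / 2 : ℂ) * (fderiv ℝ g p 1 j + Complex.I * fderiv ℝ g p Complex.I j)

/-- `u_z = ½ (u_x − i u_y)` for a real-valued function `u : ℂ → ℝ`. -/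
def dzR (u : ℂ → ℝ) (p : ℂ) : ℂ :=
  (1 / 2 : ℂ) * ((fderiv ℝ u p 1 : ℂ) - Complex.I * (fderiv ℝ u p Complex.I : ℂ))

/-- `u_{z̄} = ½ (u_x + i u_y)` for a real-valued function `u : ℂ → ℝ`. -/
def dzbarR (u : ℂ → ℝ) (p : ℂ) : ℂ :=
  (1 / 2 : ℂ) * ((fderiv ℝ u p 1 : ℂ) + Complex.I * (fderiv ℝ u p Complex.I : ℂ))

/-- `g_z = ½ (g_x − i g_y)` for a complex-valued function `g : ℂ → ℂ`. -/
def dzS (g : ℂ → ℂ) (p : ℂ) : ℂ :=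
  (1 / 2 : ℂ) * (fderiv ℝ g p 1 - Complex.I * fderiv ℝ g p Complex.I)

/-- `g_{z̄} = ½ (g_x + i g_y)` for a complex-valued function `g : ℂ → ℂ`. -/
def dzbarS (g : ℂ → ℂ) (p : ℂ) : ℂ :=
  (1 / 2 : ℂ) * (fderiv ℝ g p 1 + Complex.I * fderiv ℝ g p Complex.I)

/-- The complexification of a vector in `ℝ⁴`. -/
def cv (x : Fin 4 → ℝ) : Fin 4 → ℂ := fun j => (x j : ℂ)

open scoped ContDiff Topology Matrix

section LorentzForm

lemma lorC_comm (x y : Fin 4 → ℂ) : lorC x y = lorC y x := by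
  simp only [lorC]; ring

lemma lorC_cv (x y : Fin 4 → ℝ) : lorC (cv x) (cv y) = (lor x y : ℂ) := by
  simp [lorC, lor, cv]

/-- Expansion of the complexified Lorentz form in a frame `f, n, a, b` in which `f, n` are
orthogonal to the rest, of square norms `1` and `-1`, and `a, b` are null. -/
lemma lorC_expand {f n a b : Fin 4 → ℂ} {E : ℂ} (hE : E ≠ 0)
    (hff : lorC f f = 1) (hnn : lorC n n = -1) (hnf : lorC n f = 0)
    (hna : lorC n a = 0) (hnb : lorC n b = 0) (haf : lorC a f = 0) (hbf : lorC b f = 0)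
    (haa : lorC a a = 0) (hbb : lorC b b = 0) (hab : lorC a b = E) (v w : Fin 4 → ℂ) :
    lorC v w = lorC v f * lorC w f - lorC v n * lorC w n
      + (lorC v a * lorC w b + lorC v b * lorC w a) / E := by
  let P : Matrix (Fin 4) (Fin 4) ℂ := !![f 0, f 1, f 2, f 3; n 0, n 1, n 2, n 3;
    a 0, a 1, a 2, a 3; b 0, b 1, b 2, b 3]
  let Q : Matrix (Fin 4) (Fin 4) ℂ := !![f 0, -n 0, b 0 / E, a 0 / E;
    f 1, -n 1, b 1 / E, a 1 / E; f 2, -n 2, b 2 / E, a 2 / E;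
    -f 3, n 3, -b 3 / E, -a 3 / E]
  have hPQ : P * Q = 1 := by
    simp only [lorC] at *
    ext i j
    fin_cases i <;> fin_cases j <;>
      simp [P, Q, Matrix.mul_apply, Fin.sum_univ_four] <;> field_simp <;> grind
  have hQP : Q * P = 1 := mul_eq_one_comm.mp hPQ
  have hw : Q *ᵥ (P *ᵥ ![w 0, w 1, w 2, -w 3]) = ![w 0, w 1, w 2, -w 3] := by
    rw [Matrix.mulVec_mulVec, hQP, Matrix.one_mulVec]
  have h0 := congrFun hw 0
  have h1 := congrFun hw 1
  have h2 := congrFun hw 2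
  have h3 := congrFun hw 3
  simp [P, Q, Matrix.mulVec, dotProduct, Fin.sum_univ_four] at h0 h1 h2 h3
  simp only [lorC]
  linear_combination -(v 0 * h0 + v 1 * h1 + v 2 * h2 + v 3 * h3)

lemma lorC_cv_dz (x : Fin 4 → ℝ) (f : ℂ → Fin 4 → ℝ) (p : ℂ) :
    lorC (cv x) (dz f p)
      = 1 / 2 * ((lor x (pdx f p) : ℂ) - Complex.I * (lor x (pdy f p) : ℂ)) := by
  simp only [lorC, lor, cv, dz]
  push_cast
  ring

lemma lorC_cv_dzbar (x : Fin 4 → ℝ) (f : ℂ → Fin 4 → ℝ) (p : ℂ) :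
    lorC (cv x) (dzbar f p)
      = 1 / 2 * ((lor x (pdx f p) : ℂ) + Complex.I * (lor x (pdy f p) : ℂ)) := by
  simp only [lorC, lor, cv, dzbar]
  push_cast
  ring

lemma lorC_dzbar_self (f : ℂ → Fin 4 → ℝ) (p : ℂ) :
    lorC (dzbar f p) (dzbar f p) = starRingEnd ℂ (lorC (dz f p) (dz f p)) := by
  simp [lorC, dz, dzbar, Complex.conj_ofNat]

end LorentzForm

section Wirtinger

lemma dzC_eq (g : ℂ → Fin 4 → ℂ) : dzC g =
    fun p => (1 / 2 : ℂ) • (fderiv ℝ g p 1 - Complex.I • fderiv ℝ g p Complex.I) := rfl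

lemma dzbarC_eq (g : ℂ → Fin 4 → ℂ) : dzbarC g =
    fun p => (1 / 2 : ℂ) • (fderiv ℝ g p 1 + Complex.I • fderiv ℝ g p Complex.I) := rfl

lemma fderiv_cv_apply {f : ℂ → Fin 4 → ℝ} {p : ℂ} (hf : DifferentiableAt ℝ f p) (v : ℂ) :
    fderiv ℝ (fun q => cv (f q)) p v = cv (fderiv ℝ f p v) := by
  have h : HasFDerivAt (fun q => cv (f q)) (ContinuousLinearMap.pi fun j =>
      Complex.ofRealCLM.comp ((ContinuousLinearMap.proj j).comp (fderiv ℝ f p))) p := by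
    rw [hasFDerivAt_pi]
    intro j
    exact Complex.ofRealCLM.hasFDerivAt.comp p (hasFDerivAt_pi'.mp hf.hasFDerivAt j)
  rw [h.fderiv]
  rfl

lemma dzC_cv {f : ℂ → Fin 4 → ℝ} {p : ℂ} (hf : DifferentiableAt ℝ f p) :
    dzC (fun q => cv (f q)) p = dz f p := by
  ext j
  simp only [dzC, dz, fderiv_cv_apply hf]
  rfl

lemma dzbarC_cv {f : ℂ → Fin 4 → ℝ} {p : ℂ} (hf : DifferentiableAt ℝ f p) :
    dzbarC (fun q => cv (f q)) p = dzbar f p := by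
  ext j
  simp only [dzbarC, dzbar, fderiv_cv_apply hf]
  rfl

lemma fderiv_lorC {g h : ℂ → Fin 4 → ℂ} {p : ℂ} (hg : DifferentiableAt ℝ g p)
    (hh : DifferentiableAt ℝ h p) (v : ℂ) :
    fderiv ℝ (fun q => lorC (g q) (h q)) p v
      = lorC (fderiv ℝ g p v) (h p) + lorC (g p) (fderiv ℝ h p v) := by
  have hg' := hasFDerivAt_pi'.mp hg.hasFDerivAt
  have hh' := hasFDerivAt_pi'.mp hh.hasFDerivAt
  have H := (((hg' 0).mul (hh' 0)).add ((hg' 1).mul (hh' 1))).add ((hg' 2).mul (hh' 2)) |>.sub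
    ((hg' 3).mul (hh' 3))
  have H' : HasFDerivAt (fun q => lorC (g q) (h q)) _ p := H
  rw [H'.fderiv]
  simp [lorC]
  ring

lemma dzS_lorC {g h : ℂ → Fin 4 → ℂ} {p : ℂ} (hg : DifferentiableAt ℝ g p)
    (hh : DifferentiableAt ℝ h p) :
    dzS (fun q => lorC (g q) (h q)) p = lorC (dzC g p) (h p) + lorC (g p) (dzC h p) := by
  simp only [dzS, fderiv_lorC hg hh]
  simp only [lorC, dzC]
  ring

lemma dzbarS_lorC {g h : ℂ → Fin 4 → ℂ} {p : ℂ} (hg : DifferentiableAt ℝ g p)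
    (hh : DifferentiableAt ℝ h p) :
    dzbarS (fun q => lorC (g q) (h q)) p
      = lorC (dzbarC g p) (h p) + lorC (g p) (dzbarC h p) := by
  simp only [dzbarS, fderiv_lorC hg hh]
  simp only [lorC, dzbarC]
  ring

lemma dzS_mul {g h : ℂ → ℂ} {p : ℂ} (hg : DifferentiableAt ℝ g p)
    (hh : DifferentiableAt ℝ h p) :
    dzS (fun q => g q * h q) p = dzS g p * h p + g p * dzS h p := by
  simp only [dzS, fderiv_fun_mul hg hh]
  simp
  ring

lemma dzS_congr {g h : ℂ → ℂ} {U : Set ℂ} (hU : IsOpen U) (hgh : ∀ q ∈ U, g q = h q)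
    {p : ℂ} (hp : p ∈ U) : dzS g p = dzS h p := by
  have : g =ᶠ[𝓝 p] h := Filter.eventually_of_mem (hU.mem_nhds hp) hgh
  simp only [dzS, this.fderiv_eq]

lemma dzbarS_congr {g h : ℂ → ℂ} {U : Set ℂ} (hU : IsOpen U) (hgh : ∀ q ∈ U, g q = h q)
    {p : ℂ} (hp : p ∈ U) : dzbarS g p = dzbarS h p := by
  have : g =ᶠ[𝓝 p] h := Filter.eventually_of_mem (hU.mem_nhds hp) hgh
  simp only [dzbarS, this.fderiv_eq]

lemma dzC_congr {g h : ℂ → Fin 4 → ℂ} {U : Set ℂ} (hU : IsOpen U)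
    (hgh : ∀ q ∈ U, g q = h q) {p : ℂ} (hp : p ∈ U) : dzC g p = dzC h p := by
  have : g =ᶠ[𝓝 p] h := Filter.eventually_of_mem (hU.mem_nhds hp) hgh
  simp only [dzC_eq, this.fderiv_eq]

lemma dzbarC_congr {g h : ℂ → Fin 4 → ℂ} {U : Set ℂ} (hU : IsOpen U)
    (hgh : ∀ q ∈ U, g q = h q) {p : ℂ} (hp : p ∈ U) : dzbarC g p = dzbarC h p := by
  have : g =ᶠ[𝓝 p] h := Filter.eventually_of_mem (hU.mem_nhds hp) hgh
  simp only [dzbarC_eq, this.fderiv_eq]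

lemma contDiffOn_cv {f : ℂ → Fin 4 → ℝ} {U : Set ℂ} (hf : ContDiffOn ℝ ∞ f U) :
    ContDiffOn ℝ ∞ (fun q => cv (f q)) U := by
  rw [contDiffOn_pi]
  intro j
  exact Complex.ofRealCLM.contDiff.comp_contDiffOn (contDiffOn_pi.mp hf j)

lemma contDiffOn_fderiv_apply {g : ℂ → Fin 4 → ℂ} {U : Set ℂ} (hU : IsOpen U)
    (hg : ContDiffOn ℝ ∞ g U) (v : ℂ) : ContDiffOn ℝ ∞ (fun q => fderiv ℝ g q v) U :=
  (hg.fderiv_of_isOpen hU (by simp)).clm_apply contDiffOn_const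

lemma contDiffOn_dzC {g : ℂ → Fin 4 → ℂ} {U : Set ℂ} (hU : IsOpen U)
    (hg : ContDiffOn ℝ ∞ g U) : ContDiffOn ℝ ∞ (dzC g) U :=
  ((contDiffOn_fderiv_apply hU hg 1).sub
    ((contDiffOn_fderiv_apply hU hg Complex.I).const_smul Complex.I)).const_smul (1 / 2 : ℂ)

lemma contDiffOn_dzbarC {g : ℂ → Fin 4 → ℂ} {U : Set ℂ} (hU : IsOpen U)
    (hg : ContDiffOn ℝ ∞ g U) : ContDiffOn ℝ ∞ (dzbarC g) U :=
  ((contDiffOn_fderiv_apply hU hg 1).add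
    ((contDiffOn_fderiv_apply hU hg Complex.I).const_smul Complex.I)).const_smul (1 / 2 : ℂ)

lemma differentiableAt_of_contDiffOn {F : Type*} [NormedAddCommGroup F] [NormedSpace ℝ F]
    {g : ℂ → F} {U : Set ℂ} (hU : IsOpen U) (hg : ContDiffOn ℝ ∞ g U)
    {p : ℂ} (hp : p ∈ U) : DifferentiableAt ℝ g p :=
  (hg.contDiffAt (hU.mem_nhds hp)).differentiableAt (by simp)

lemma differentiableAt_lorC {g h : ℂ → Fin 4 → ℂ} {p : ℂ} (hg : DifferentiableAt ℝ g p)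
    (hh : DifferentiableAt ℝ h p) : DifferentiableAt ℝ (fun q => lorC (g q) (h q)) p := by
  have hg' := differentiableAt_pi.mp hg
  have hh' := differentiableAt_pi.mp hh
  exact (((hg' 0).mul (hh' 0)).add ((hg' 1).mul (hh' 1))).add ((hg' 2).mul (hh' 2)) |>.sub
    ((hg' 3).mul (hh' 3))

lemma dzC_dzbarC_comm {g : ℂ → Fin 4 → ℂ} {U : Set ℂ} (hU : IsOpen U)
    (hg : ContDiffOn ℝ ∞ g U) {p : ℂ} (hp : p ∈ U) :
    dzC (dzbarC g) p = dzbarC (dzC g) p := by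
  have hd (v : ℂ) : DifferentiableAt ℝ (fun q => fderiv ℝ g q v) p :=
    differentiableAt_of_contDiffOn hU (contDiffOn_fderiv_apply hU hg v) hp
  have hd' : DifferentiableAt ℝ (fderiv ℝ g) p :=
    differentiableAt_of_contDiffOn hU (hg.fderiv_of_isOpen hU (by simp)) hp
  have hv (v w : ℂ) : fderiv ℝ (fun q => fderiv ℝ g q v) p w
      = fderiv ℝ (fderiv ℝ g) p w v := by
    rw [fderiv_clm_apply hd' (differentiableAt_const v)]
    simp
  have hsymm : fderiv ℝ (fderiv ℝ g) p 1 Complex.I = fderiv ℝ (fderiv ℝ g) p Complex.I 1 :=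
    (hg.contDiffAt (hU.mem_nhds hp)).isSymmSndFDerivAt (by simpa using WithTop.coe_le_coe.mpr (le_top (a := (2 : ℕ∞)))) 1 Complex.I
  have h1 (w : ℂ) : fderiv ℝ (dzC g) p w = (1 / 2 : ℂ) • (fderiv ℝ (fderiv ℝ g) p w 1
      - Complex.I • fderiv ℝ (fderiv ℝ g) p w Complex.I) := by
    have := (((hd 1).hasFDerivAt).sub ((hd Complex.I).hasFDerivAt.const_smul Complex.I)).const_smul
      (1 / 2 : ℂ)
    have h' : HasFDerivAt (dzC g) _ p := this
    rw [h'.fderiv, ← hv, ← hv]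
    rfl
  have h2 (w : ℂ) : fderiv ℝ (dzbarC g) p w = (1 / 2 : ℂ) • (fderiv ℝ (fderiv ℝ g) p w 1
      + Complex.I • fderiv ℝ (fderiv ℝ g) p w Complex.I) := by
    have := (((hd 1).hasFDerivAt).add ((hd Complex.I).hasFDerivAt.const_smul Complex.I)).const_smul
      (1 / 2 : ℂ)
    have h' : HasFDerivAt (dzbarC g) _ p := this
    rw [h'.fderiv, ← hv, ← hv]
    rfl
  rw [dzC_eq (dzbarC g), dzbarC_eq (dzC g)]
  ext j
  simp only [h1, h2, hsymm, Pi.smul_apply, Pi.add_apply, Pi.sub_apply, smul_eq_mul]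
  ring

lemma dzS_const_on {g : ℂ → ℂ} {U : Set ℂ} (hU : IsOpen U) {c : ℂ} (hg : ∀ q ∈ U, g q = c)
    {p : ℂ} (hp : p ∈ U) : dzS g p = 0 := by
  rw [dzS_congr hU hg hp]
  simp [dzS]

lemma dzbarS_const_on {g : ℂ → ℂ} {U : Set ℂ} (hU : IsOpen U) {c : ℂ} (hg : ∀ q ∈ U, g q = c)
    {p : ℂ} (hp : p ∈ U) : dzbarS g p = 0 := by
  rw [dzbarS_congr hU hg hp]
  simp [dzbarS]

lemma fderiv_eq_zero_of_dzS_ofReal {H : ℂ → ℝ} {p : ℂ}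
    (hd : DifferentiableAt ℝ H p) (h : dzS (fun q => (H q : ℂ)) p = 0) :
    fderiv ℝ H p = 0 := by
  have hv (v : ℂ) : fderiv ℝ (fun q => (H q : ℂ)) p v = (fderiv ℝ H p v : ℂ) := by
    have h' : HasFDerivAt (fun q => (H q : ℂ)) _ p :=
      Complex.ofRealCLM.hasFDerivAt.comp p hd.hasFDerivAt
    rw [h'.fderiv]
    rfl
  simp only [dzS, hv] at h
  have hre := congrArg Complex.re h
  have him := congrArg Complex.im h
  simp at hre him
  ext v
  have hv' : v = v.re • (1 : ℂ) + v.im • Complex.I := by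
    simp [Complex.re_add_im]
  rw [hv', map_add, map_smul, map_smul, hre, him]
  simp

end Wirtinger

section Codazzi

variable {U : Set ℂ} {F N : ℂ → Fin 4 → ℂ}

/-- Differentiating an orthogonality relation `⟨g, h⟩ = c` in `z`. -/
lemma lorC_dzC_add_eq_zero (hU : IsOpen U) {g h : ℂ → Fin 4 → ℂ} {c : ℂ}
    (hg : ContDiffOn ℝ ∞ g U) (hh : ContDiffOn ℝ ∞ h U) (hc : ∀ q ∈ U, lorC (g q) (h q) = c)
    {p : ℂ} (hp : p ∈ U) : lorC (dzC g p) (h p) + lorC (g p) (dzC h p) = 0 := by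
  rw [← dzS_lorC (differentiableAt_of_contDiffOn hU hg hp)
    (differentiableAt_of_contDiffOn hU hh hp)]
  exact dzS_const_on hU hc hp

/-- Differentiating an orthogonality relation `⟨g, h⟩ = c` in `z̄`. -/
lemma lorC_dzbarC_add_eq_zero (hU : IsOpen U) {g h : ℂ → Fin 4 → ℂ} {c : ℂ}
    (hg : ContDiffOn ℝ ∞ g U) (hh : ContDiffOn ℝ ∞ h U) (hc : ∀ q ∈ U, lorC (g q) (h q) = c)
    {p : ℂ} (hp : p ∈ U) : lorC (dzbarC g p) (h p) + lorC (g p) (dzbarC h p) = 0 := by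
  rw [← dzbarS_lorC (differentiableAt_of_contDiffOn hU hg hp)
    (differentiableAt_of_contDiffOn hU hh hp)]
  exact dzbarS_const_on hU hc hp

/-- The Codazzi equation, in terms of `E = ⟨F_z, F_z̄⟩`, `ξ = ⟨F_z, N_z⟩` and
`E H = ⟨F_z, N_z̄⟩`. -/
lemma codazzi (hU : IsOpen U) (hF : ContDiffOn ℝ ∞ F U) (hN : ContDiffOn ℝ ∞ N U)
    (hFF : ∀ q ∈ U, lorC (F q) (F q) = 1) (hNN : ∀ q ∈ U, lorC (N q) (N q) = -1)
    (hNF : ∀ q ∈ U, lorC (N q) (F q) = 0)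
    (hNa : ∀ q ∈ U, lorC (N q) (dzC F q) = 0) (hNb : ∀ q ∈ U, lorC (N q) (dzbarC F q) = 0)
    (haa : ∀ q ∈ U, lorC (dzC F q) (dzC F q) = 0)
    (hbb : ∀ q ∈ U, lorC (dzbarC F q) (dzbarC F q) = 0)
    (hE : ∀ q ∈ U, lorC (dzC F q) (dzbarC F q) ≠ 0) {p : ℂ} (hp : p ∈ U) :
    dzbarS (fun q => lorC (dzC F q) (dzC N q)) p * lorC (dzC F p) (dzbarC F p)
      = dzS (fun q => lorC (dzC F q) (dzbarC N q)) p * lorC (dzC F p) (dzbarC F p)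
        - dzS (fun q => lorC (dzC F q) (dzbarC F q)) p * lorC (dzC F p) (dzbarC N p) := by
  have hFz := contDiffOn_dzC hU hF
  have hFb := contDiffOn_dzbarC hU hF
  have hNz := contDiffOn_dzC hU hN
  have hNb' := contDiffOn_dzbarC hU hN
  have dFz := differentiableAt_of_contDiffOn hU hFz hp
  have dFb := differentiableAt_of_contDiffOn hU hFb hp
  have dNz := differentiableAt_of_contDiffOn hU hNz hp
  have dNb := differentiableAt_of_contDiffOn hU hNb' hp
  have haF : lorC (dzC F p) (F p) = 0 := by
    have := lorC_dzC_add_eq_zero hU hF hF hFF hp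
    rw [lorC_comm (F p)] at this
    linear_combination this / 2
  have hbF : lorC (dzbarC F p) (F p) = 0 := by
    have := lorC_dzbarC_add_eq_zero hU hF hF hFF hp
    rw [lorC_comm (F p)] at this
    linear_combination this / 2
  have hNzN : lorC (dzC N p) (N p) = 0 := by
    have := lorC_dzC_add_eq_zero hU hN hN hNN hp
    rw [lorC_comm (N p)] at this
    linear_combination this / 2
  have hNbN : lorC (dzbarC N p) (N p) = 0 := by
    have := lorC_dzbarC_add_eq_zero hU hN hN hNN hp
    rw [lorC_comm (N p)] at this
    linear_combination this / 2
  have hNzF : lorC (dzC N p) (F p) = 0 := by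
    have := lorC_dzC_add_eq_zero hU hN hF hNF hp
    rwa [hNa p hp, add_zero] at this
  have hNbF : lorC (dzbarC N p) (F p) = 0 := by
    have := lorC_dzbarC_add_eq_zero hU hN hF hNF hp
    rwa [hNb p hp, add_zero] at this
  have hcF := dzC_dzbarC_comm hU hF hp
  have hcN := dzC_dzbarC_comm hU hN hp
  have hzza : lorC (dzC (dzC F) p) (dzC F p) = 0 := by
    have := lorC_dzC_add_eq_zero hU hFz hFz haa hp
    rw [lorC_comm (dzC F p)] at this
    linear_combination this / 2
  have hzba : lorC (dzbarC (dzC F) p) (dzC F p) = 0 := by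
    have := lorC_dzbarC_add_eq_zero hU hFz hFz haa hp
    rw [lorC_comm (dzC F p)] at this
    linear_combination this / 2
  have hzbb : lorC (dzbarC (dzC F) p) (dzbarC F p) = 0 := by
    have := lorC_dzC_add_eq_zero hU hFb hFb hbb hp
    rw [lorC_comm (dzbarC F p), hcF] at this
    linear_combination this / 2
  have hEz := dzS_lorC dFz dFb
  rw [hcF, lorC_comm (dzC F p) (dzbarC (dzC F) p), hzba, add_zero] at hEz
  have hexp := lorC_expand (hE p hp) (hFF p hp) (hNN p hp) (hNF p hp) (hNa p hp) (hNb p hp)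
    haF hbF (haa p hp) (hbb p hp) rfl
  have h1 := hexp (dzbarC (dzC F) p) (dzC N p)
  rw [hNzF, hNzN, hzba, hzbb] at h1
  have h2 := hexp (dzC (dzC F) p) (dzbarC N p)
  rw [hNbF, hNbN, hzza, ← hEz, lorC_comm (dzbarC N p) (dzC F p)] at h2
  rw [dzbarS_lorC dFz dNz, dzS_lorC dFz dNb, hcN, h1, h2]
  field_simp [hE p hp]
  ring

end Codazzi


/- Standing assumptions: `f : U → S³₁` is a smooth conformal immersion; `n` is the unit
timelike normal along `f`; `u` is the conformal factor, `e^{2u} = ⟨f_z, f_{z̄}⟩^c`;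
`H` is the (real-valued) mean curvature `H = −e^{−2u}⟨f_{z̄z}, n⟩^c`; and
`ξ = −⟨f_{zz}, n⟩^c` is the Hopf coefficient. -/
/-- For `U` connected: `H` is constant on `U` iff `ξ` is holomorphic on `U`
(i.e. `ξ_{z̄} = 0` identically on `U`). -/
theorem stmt8
    (U : Set ℂ) (hU : IsOpen U)
    (f n : ℂ → Fin 4 → ℝ) (u H : ℂ → ℝ) (ξ : ℂ → ℂ)
    (hf : ContDiffOn ℝ (⊤ : ℕ∞) f U) (hn : ContDiffOn ℝ (⊤ : ℕ∞) n U)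
    (hu : ContDiffOn ℝ (⊤ : ℕ∞) u U)
    (hS : ∀ p ∈ U, lor (f p) (f p) = 1)
    (hconf : ∀ p ∈ U, lorC (dz f p) (dz f p) = 0)
    (himm : ∀ p ∈ U, LinearIndependent ℝ ![pdx f p, pdy f p])
    (hn1 : ∀ p ∈ U, lor (n p) (n p) = -1)
    (hn2 : ∀ p ∈ U, lor (n p) (f p) = 0)
    (hn3 : ∀ p ∈ U, lor (n p) (pdx f p) = 0 ∧ lor (n p) (pdy f p) = 0)
    (huE : ∀ p ∈ U, (Real.exp (2 * u p) : ℂ) = lorC (dz f p) (dzbar f p))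
    (hH : ∀ p ∈ U, (H p : ℂ) = -(Real.exp (-(2 * u p)) : ℂ) * lorC (dzbarC (dz f) p) (cv (n p)))
    (hxi : ∀ p ∈ U, ξ p = -lorC (dzC (dz f) p) (cv (n p)))
    (hconn : IsConnected U) :
    (∀ p ∈ U, ∀ q ∈ U, H p = H q) ↔ (∀ p ∈ U, dzbarS ξ p = 0) := by
  have hF := contDiffOn_cv hf
  have hN := contDiffOn_cv hn
  set F : ℂ → Fin 4 → ℂ := fun q => cv (f q)
  set N : ℂ → Fin 4 → ℂ := fun q => cv (n q)
  have hz : ∀ p ∈ U, dz f p = dzC F p := fun p hp =>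
    (dzC_cv (differentiableAt_of_contDiffOn hU hf hp)).symm
  have hb : ∀ p ∈ U, dzbar f p = dzbarC F p := fun p hp =>
    (dzbarC_cv (differentiableAt_of_contDiffOn hU hf hp)).symm
  have hFz := contDiffOn_dzC hU hF
  have hFb := contDiffOn_dzbarC hU hF
  have hNz := contDiffOn_dzC hU hN
  have hNb := contDiffOn_dzbarC hU hN
  have hFF : ∀ q ∈ U, lorC (F q) (F q) = 1 := fun q hq => by simp [F, lorC_cv, hS q hq]
  have hNN : ∀ q ∈ U, lorC (N q) (N q) = -1 := fun q hq => by simp [N, lorC_cv, hn1 q hq]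
  have hNF : ∀ q ∈ U, lorC (N q) (F q) = 0 := fun q hq => by simp [F, N, lorC_cv, hn2 q hq]
  have hna : ∀ q ∈ U, lorC (N q) (dzC F q) = 0 := fun q hq => by
    rw [← hz q hq, lorC_cv_dz, (hn3 q hq).1, (hn3 q hq).2]
    simp
  have hnb : ∀ q ∈ U, lorC (N q) (dzbarC F q) = 0 := fun q hq => by
    rw [← hb q hq, lorC_cv_dzbar, (hn3 q hq).1, (hn3 q hq).2]
    simp
  have haa : ∀ q ∈ U, lorC (dzC F q) (dzC F q) = 0 := fun q hq => by
    rw [← hz q hq, hconf q hq]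
  have hbb : ∀ q ∈ U, lorC (dzbarC F q) (dzbarC F q) = 0 := fun q hq => by
    rw [← hb q hq, lorC_dzbar_self, hconf q hq, map_zero]
  have hEu : ∀ q ∈ U, lorC (dzC F q) (dzbarC F q) = (Real.exp (2 * u q) : ℂ) := fun q hq => by
    rw [← hz q hq, ← hb q hq, huE q hq]
  have hE : ∀ q ∈ U, lorC (dzC F q) (dzbarC F q) ≠ 0 := fun q hq => by
    rw [hEu q hq]
    exact_mod_cast (Real.exp_pos _).ne'
  have hξ : ∀ q ∈ U, ξ q = lorC (dzC F q) (dzC N q) := fun q hq => by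
    have h := lorC_dzC_add_eq_zero hU hN hFz hna hq
    rw [hxi q hq, dzC_congr hU hz hq, lorC_comm (dzC F q), lorC_comm (dzC (dzC F) q)]
    linear_combination -h
  have hHE : ∀ q ∈ U, (H q : ℂ) * lorC (dzC F q) (dzbarC F q) = lorC (dzC F q) (dzbarC N q) :=
    fun q hq => by
    have h := lorC_dzbarC_add_eq_zero hU hN hFz hna hq
    have hexp : (Real.exp (-(2 * u q)) : ℂ) * (Real.exp (2 * u q) : ℂ) = 1 := by
      rw [← Complex.ofReal_mul, ← Real.exp_add]
      simp
    rw [hEu q hq, hH q hq, dzbarC_congr hU hz hq, lorC_comm (dzC F q),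
      lorC_comm (dzbarC (dzC F) q)]
    linear_combination -h - lorC (N q) (dzbarC (dzC F) q) * hexp
  have hdH : ∀ q ∈ U, DifferentiableAt ℝ H q := fun q hq => by
    have hG := differentiableAt_lorC (differentiableAt_of_contDiffOn hU hFz hq)
      (differentiableAt_of_contDiffOn hU hNb hq)
    have hquot := hG.fun_mul ((differentiableAt_lorC (differentiableAt_of_contDiffOn hU hFz hq)
      (differentiableAt_of_contDiffOn hU hFb hq)).fun_inv (hE q hq))
    have hd : DifferentiableAt ℝ
        (fun q => (lorC (dzC F q) (dzbarC N q) * (lorC (dzC F q) (dzbarC F q))⁻¹).re) q :=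
      Complex.reCLM.differentiableAt.comp q hquot
    refine hd.congr_of_eventuallyEq (Filter.eventually_of_mem (hU.mem_nhds hq) fun r hr => ?_)
    simp only [← hHE r hr, mul_inv_cancel_right₀ (hE r hr), Complex.ofReal_re]
  have hcod : ∀ p ∈ U, dzbarS ξ p
      = dzS (fun q => (H q : ℂ)) p * lorC (dzC F p) (dzbarC F p) := fun p hp => by
    have h := codazzi hU hF hN hFF hNN hNF hna hnb haa hbb hE hp
    have hdHc : DifferentiableAt ℝ (fun q => (H q : ℂ)) p :=
      Complex.ofRealCLM.differentiableAt.comp p (hdH p hp)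
    rw [← dzbarS_congr hU hξ hp, ← dzS_congr hU hHE hp, dzS_mul hdHc (differentiableAt_lorC
      (differentiableAt_of_contDiffOn hU hFz hp) (differentiableAt_of_contDiffOn hU hFb hp)),
      ← hHE p hp] at h
    apply mul_right_cancel₀ (hE p hp)
    linear_combination h
  constructor
  · intro hconst p hp
    rw [hcod p hp, dzS_const_on hU (fun q hq => congrArg Complex.ofReal (hconst q hq p hp)) hp,
      zero_mul]
  · intro hhol p hp q hq
    refine hU.is_const_of_fderiv_eq_zero (𝕜 := ℝ) hconn.isPreconnected
      (fun r hr => (hdH r hr).differentiableWithinAt) (fun r hr => ?_) hp hq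
    have h := hcod r hr
    rw [hhol r hr] at h
    exact fderiv_eq_zero_of_dzS_ofReal (hdH r hr)
      ((mul_eq_zero.mp h.symm).resolve_right (hE r hr))
end
end

section
/- Let A ∈ M₂(ℝ) with AᵀA = I₂ and det A = 1, and let k = diag(1, A, 1) ∈ M₄(ℝ) be the corresponding block-diagonal matrix. Then for every X ∈ 𝔭 one has k·X·k⁻¹ ∈ 𝔭, and for every X ∈ 𝒽 one has k·X·k⁻¹ ∈ 𝒽; that is, both 𝔭 and 𝒽 are Ad(K)-invariant subspaces of M₄(ℝ), where K = {diag(1, A, 1) : A ∈ SO(2)}. -/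
noncomputable section

open Matrix

/-- The general element of the subspace `𝔭 ⊂ M₄(ℝ)`, with parameters `x₂, x₃, x₄, y₂, y₃`. -/
def Pmat (x2 x3 x4 y2 y3 : ℝ) : Matrix (Fin 4) (Fin 4) ℝ :=
  Matrix.of ![![0, x2, x3, x4], ![-x2, 0, 0, y2], ![-x3, 0, 0, y3], ![x4, y2, y3, 0]]

/-- The block-diagonal matrix `diag(1, A, 1)` for `A ∈ M₂(ℝ)`. -/
def kMat (A : Matrix (Fin 2) (Fin 2) ℝ) : Matrix (Fin 4) (Fin 4) ℝ :=
  Matrix.of ![![1, 0, 0, 0], ![0, A 0 0, A 0 1, 0], ![0, A 1 0, A 1 1, 0], ![0, 0, 0, 1]]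

theorem det_kMat (A : Matrix (Fin 2) (Fin 2) ℝ) : (kMat A).det = A.det := by
  simp [kMat, Matrix.det_succ_row_zero, Fin.sum_univ_succ, Fin.succAbove]

/-- Conjugation by `diag(1, A, 1)` acts on the pairs `(x₂, x₃)` and `(y₂, y₃)` through `A` and
fixes `x₄`. -/
theorem kMat_mul_Pmat_mul_inv (A : Matrix (Fin 2) (Fin 2) ℝ) (hA : Aᵀ * A = 1)
    (hdetA : A.det = 1) (x2 x3 x4 y2 y3 : ℝ) :
    kMat A * Pmat x2 x3 x4 y2 y3 * (kMat A)⁻¹ =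
      Pmat (A 0 0 * x2 + A 0 1 * x3) (A 1 0 * x2 + A 1 1 * x3) x4
        (A 0 0 * y2 + A 0 1 * y3) (A 1 0 * y2 + A 1 1 * y3) := by
  have h00 : A 0 0 * A 0 0 + A 1 0 * A 1 0 = 1 := by
    simpa [Matrix.mul_apply] using congrFun (congrFun hA 0) 0
  have h01 : A 0 0 * A 0 1 + A 1 0 * A 1 1 = 0 := by
    simpa [Matrix.mul_apply] using congrFun (congrFun hA 0) 1
  have h11 : A 0 1 * A 0 1 + A 1 1 * A 1 1 = 1 := by
    simpa [Matrix.mul_apply] using congrFun (congrFun hA 1) 1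
  have hk : IsUnit (kMat A).det := by simp [det_kMat, hdetA]
  let := Matrix.invertibleOfIsUnitDet _ hk
  rw [Matrix.mul_inv_eq_iff_eq_mul_of_invertible]
  ext i j
  fin_cases i <;> fin_cases j <;>
    simp [kMat, Pmat, Matrix.mul_apply, Fin.sum_univ_succ] <;> grind

/-- Both `𝔭` and its subspace `𝒽` (matrices in `𝔭` with `x₄ = 0`) are `Ad(K)`-invariant:
for `k = diag(1, A, 1)` with `A ∈ SO(2)`, `Ad(k) = k·(-)·k⁻¹` maps `𝔭` into `𝔭`
and `𝒽` into `𝒽`. -/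
theorem stmt10 (A : Matrix (Fin 2) (Fin 2) ℝ) (hA : Aᵀ * A = 1) (hdetA : A.det = 1) :
    (∀ X : Matrix (Fin 4) (Fin 4) ℝ, (∃ x2 x3 x4 y2 y3 : ℝ, X = Pmat x2 x3 x4 y2 y3) →
        ∃ x2 x3 x4 y2 y3 : ℝ, kMat A * X * (kMat A)⁻¹ = Pmat x2 x3 x4 y2 y3) ∧
    (∀ X : Matrix (Fin 4) (Fin 4) ℝ, (∃ x2 x3 y2 y3 : ℝ, X = Pmat x2 x3 0 y2 y3) →
        ∃ x2 x3 y2 y3 : ℝ, kMat A * X * (kMat A)⁻¹ = Pmat x2 x3 0 y2 y3) := by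
  constructor
  · rintro _ ⟨x2, x3, x4, y2, y3, rfl⟩
    exact ⟨_, _, _, _, _, kMat_mul_Pmat_mul_inv A hA hdetA x2 x3 x4 y2 y3⟩
  · rintro _ ⟨x2, x3, y2, y3, rfl⟩
    exact ⟨_, _, _, _, kMat_mul_Pmat_mul_inv A hA hdetA x2 x3 0 y2 y3⟩
end
end

section
/- Let (v,w) and (v',w') be pairs of vectors in ℝ⁴ satisfying ⟨v,v⟩ = ⟨v',v'⟩ = 1, ⟨w,w⟩ = ⟨w',w'⟩ = −1, ⟨v,w⟩ = ⟨v',w'⟩ = 0, w₄ > 0 and w'₄ > 0 (i.e. both pairs are points of the twistor space 𝒵). Then v' ∧ w' = v ∧ w in Λ²(ℝ⁴) (equivalently, the alternating 2-tensor v'⊗w' − w'⊗v' equals v⊗w − w⊗v) if and only if there exists t ∈ ℝ with v' = cosh(t)·v + sinh(t)·w and w' = sinh(t)·v + cosh(t)·w. Hence the fibers of the projection (v,w) ↦ [v ∧ w]⊥ are exactly the orbits of the one-parameter boost action of SO₀(1,1). -/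
noncomputable section

lemma lor_comm (x y : Fin 4 → ℝ) : lor x y = lor y x := by
  simp only [lor]
  ring

lemma lor_comb_left (a b : ℝ) (x y z : Fin 4 → ℝ) :
    lor (fun i => a * x i + b * y i) z = a * lor x z + b * lor y z := by
  simp only [lor]
  ring

/-- Equal bivectors have equal contractions with every vector. -/
lemma contract_eq_of_wedge_eq {v w v' w' : Fin 4 → ℝ}
    (h : ∀ i j : Fin 4, v' i * w' j - w' i * v' j = v i * w j - w i * v j)
    (z : Fin 4 → ℝ) (i : Fin 4) :
    v' i * lor w' z - w' i * lor v' z = v i * lor w z - w i * lor v z := by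
  simp only [lor]
  linear_combination z 0 * h i 0 + z 1 * h i 1 + z 2 * h i 2 - z 3 * h i 3

/-- Two future-pointing unit timelike vectors have negative Lorentz product. -/
lemma lor_neg_of_future {w w' : Fin 4 → ℝ} (hw : lor w w = -1) (hw' : lor w' w' = -1)
    (hw4 : 0 < w 3) (hw4' : 0 < w' 3) : lor w w' < 0 := by
  simp only [lor] at *
  set p := w 0 * w 0 + w 1 * w 1 + w 2 * w 2 with hp
  set q := w' 0 * w' 0 + w' 1 * w' 1 + w' 2 * w' 2 with hq
  have cauchy : (w 0 * w' 0 + w 1 * w' 1 + w 2 * w' 2) ^ 2 ≤ p * q := by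
    rw [hp, hq]
    nlinarith [sq_nonneg (w 0 * w' 1 - w 1 * w' 0), sq_nonneg (w 0 * w' 2 - w 2 * w' 0),
      sq_nonneg (w 1 * w' 2 - w 2 * w' 1)]
  have hp0 : 0 ≤ p := by
    rw [hp]
    nlinarith only [sq_nonneg (w 0), sq_nonneg (w 1), sq_nonneg (w 2)]
  have hq0 : 0 ≤ q := by
    rw [hq]
    nlinarith only [sq_nonneg (w' 0), sq_nonneg (w' 1), sq_nonneg (w' 2)]
  have key : (w 0 * w' 0 + w 1 * w' 1 + w 2 * w' 2) ^ 2 < (w 3 * w' 3) ^ 2 := by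
    have e : (w 3 * w' 3) ^ 2 = (p + 1) * (q + 1) := by
      rw [show p + 1 = w 3 * w 3 by linarith, show q + 1 = w' 3 * w' 3 by linarith]
      ring
    rw [e]
    nlinarith
  linarith [(abs_lt_of_sq_lt_sq' key (by positivity)).2]

/-- For two points `(v,w)`, `(v',w')` of the twistor space `𝒵` (i.e. `⟨v,v⟩ = 1`,
`⟨w,w⟩ = −1`, `⟨v,w⟩ = 0`, `w₄ > 0`), one has `v' ∧ w' = v ∧ w` iff `(v',w')` is obtained
from `(v,w)` by the boost action of `SO₀(1,1)`:
`v' = cosh(t)v + sinh(t)w`, `w' = sinh(t)v + cosh(t)w` for some `t ∈ ℝ`. -/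
theorem stmt11 (v w v' w' : Fin 4 → ℝ)
    (hv : lor v v = 1) (hv' : lor v' v' = 1)
    (hw : lor w w = -1) (hw' : lor w' w' = -1)
    (hvw : lor v w = 0) (hvw' : lor v' w' = 0)
    (hw4 : 0 < w 3) (hw4' : 0 < w' 3) :
    (∀ i j : Fin 4, v' i * w' j - w' i * v' j = v i * w j - w i * v j) ↔
      ∃ t : ℝ, v' = (fun i => Real.cosh t * v i + Real.sinh t * w i) ∧
               w' = (fun i => Real.sinh t * v i + Real.cosh t * w i) := by
  constructor
  · intro h
    have ev : v' = fun i => -lor w w' * v i + lor v w' * w i := by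
      funext i
      linear_combination -contract_eq_of_wedge_eq h w' i + v' i * hw' - w' i * hvw'
    have hwv' : lor w' v' = 0 := (lor_comm w' v').trans hvw'
    have ew : w' = fun i => -lor w v' * v i + lor v v' * w i := by
      funext i
      linear_combination -contract_eq_of_wedge_eq h v' i + v' i * hwv'
        - w' i * hv'
    have ha : 0 < -lor w w' := neg_pos.2 (lor_neg_of_future hw hw' hw4 hw4')
    have hwv : lor w v = 0 := (lor_comm w v).trans hvw
    have lor_v' (z : Fin 4 → ℝ) : lor v' z = -lor w w' * lor v z + lor v w' * lor w z :=
      (congrArg (lor · z) ev).trans (lor_comb_left _ _ _ _ _)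
    have hd : lor v v' = -lor w w' := by
      rw [lor_comm, lor_v' v, hv, hwv]
      ring
    have hc : -lor w v' = lor v w' := by
      rw [lor_comm, lor_v' w, hw, hvw]
      ring
    have hsq : (-lor w w') ^ 2 = 1 + lor v w' ^ 2 := by
      linear_combination hv' - lor_v' v' + lor w w' * hd + lor v w' * hc
    rw [hc, hd] at ew
    have hcosh : Real.cosh (Real.arsinh (lor v w')) = -lor w w' := by
      rw [Real.cosh_arsinh, ← hsq, Real.sqrt_sq ha.le]
    exact ⟨Real.arsinh (lor v w'), by rwa [hcosh, Real.sinh_arsinh],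
      by rwa [hcosh, Real.sinh_arsinh]⟩
  · rintro ⟨t, rfl, rfl⟩ i j
    linear_combination (v i * w j - w i * v j) * Real.cosh_sq_sub_sinh_sq t
end
end

section
/- Let J' and J'' be the linear maps of 𝒽 to itself given in the parameters (x₂, x₃, y₂, y₃) by J'(x₂, x₃, y₂, y₃) = (−x₃, x₂, −y₃, y₂) and J''(x₂, x₃, y₂, y₃) = (−x₃, x₂, y₃, −y₂). Then for J ∈ {J', J''}: (a) J is orthogonal for the normal metric, i.e. ⟨J X, J Y⟩ = ⟨X, Y⟩ for all X, Y ∈ 𝒽, where ⟨X, Y⟩ = −½·trace(X·Y); and (b) J commutes with Ad(k) for every k ∈ K, i.e. k·(J X)·k⁻¹ = J(k·X·k⁻¹) for all X ∈ 𝒽 and all k = diag(1, A, 1) with A ∈ SO(2). -/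
noncomputable section

open Matrix

/-- The general element of `𝒽 ⊂ M₄(ℝ)`, with parameters `(x₂, x₃, y₂, y₃)`. -/
def Hmat (x2 x3 y2 y3 : ℝ) : Matrix (Fin 4) (Fin 4) ℝ :=
  Matrix.of ![![0, x2, x3, 0], ![-x2, 0, 0, y2], ![-x3, 0, 0, y3], ![0, y2, y3, 0]]

/-- The almost complex structure `J'` on `𝒽`: `(x₂,x₃,y₂,y₃) ↦ (−x₃,x₂,−y₃,y₂)`
(expressed through the matrix entries, so that it is defined on all of `M₄(ℝ)` and
restricts to `J'` on `𝒽`). -/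
def Jp (X : Matrix (Fin 4) (Fin 4) ℝ) : Matrix (Fin 4) (Fin 4) ℝ :=
  Hmat (-(X 0 2)) (X 0 1) (-(X 2 3)) (X 1 3)

/-- The almost complex structure `J''` on `𝒽`: `(x₂,x₃,y₂,y₃) ↦ (−x₃,x₂,y₃,−y₂)`. -/
def Jpp (X : Matrix (Fin 4) (Fin 4) ℝ) : Matrix (Fin 4) (Fin 4) ℝ :=
  Hmat (-(X 0 2)) (X 0 1) (X 2 3) (-(X 1 3))

/-- A special orthogonal `2 × 2` matrix is a rotation matrix. -/
theorem entries_of_special_orthogonal {A : Matrix (Fin 2) (Fin 2) ℝ} (hA : Aᵀ * A = 1)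
    (hdet : A.det = 1) : A 1 1 = A 0 0 ∧ A 0 1 = -A 1 0 := by
  have h00 := congrFun (congrFun hA 0) 0
  have h01 := congrFun (congrFun hA 0) 1
  simp only [Matrix.mul_apply, Fin.sum_univ_two, Matrix.transpose_apply, Matrix.one_apply_eq,
    Matrix.one_apply_ne (zero_ne_one' (Fin 2))] at h00 h01
  rw [Matrix.det_fin_two] at hdet
  refine ⟨?_, ?_⟩
  · linear_combination A 0 0 * hdet + A 1 0 * h01 - A 1 1 * h00
  · linear_combination A 0 0 * h01 - A 1 0 * hdet - A 0 1 * h00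

theorem kMat_inv {A : Matrix (Fin 2) (Fin 2) ℝ} (hA : Aᵀ * A = 1) : (kMat A)⁻¹ = kMat Aᵀ := by
  apply Matrix.inv_eq_left_inv
  have h (i j : Fin 2) := congrFun (congrFun hA i) j
  simp only [Matrix.mul_apply, Fin.sum_univ_two, Matrix.transpose_apply] at h
  ext i j
  fin_cases i <;> fin_cases j <;> simp [kMat, Matrix.mul_apply, Fin.sum_univ_four, h]

/-- `diag(1, A, 1)` acts on both parameter pairs of `𝒽` through `A`. -/
theorem kMat_mul_Hmat_mul_kMat_transpose (A : Matrix (Fin 2) (Fin 2) ℝ) (x2 x3 y2 y3 : ℝ) :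
    kMat A * Hmat x2 x3 y2 y3 * kMat Aᵀ =
      Hmat (A 0 0 * x2 + A 0 1 * x3) (A 1 0 * x2 + A 1 1 * x3)
        (A 0 0 * y2 + A 0 1 * y3) (A 1 0 * y2 + A 1 1 * y3) := by
  ext i j
  fin_cases i <;> fin_cases j <;>
    simp [kMat, Hmat, Matrix.mul_apply, Fin.sum_univ_four] <;> ring

theorem Jp_Hmat (x2 x3 y2 y3 : ℝ) : Jp (Hmat x2 x3 y2 y3) = Hmat (-x3) x2 (-y3) y2 := by
  simp [Jp, Hmat]

theorem Jpp_Hmat (x2 x3 y2 y3 : ℝ) : Jpp (Hmat x2 x3 y2 y3) = Hmat (-x3) x2 y3 (-y2) := by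
  simp [Jpp, Hmat]

theorem trace_Hmat_mul_Hmat (x2 x3 y2 y3 x2' x3' y2' y3' : ℝ) :
    (Hmat x2 x3 y2 y3 * Hmat x2' x3' y2' y3').trace =
      2 * (y2 * y2' + y3 * y3' - x2 * x2' - x3 * x3') := by
  simp [Hmat, Matrix.trace, Fin.sum_univ_four]
  ring

/-- For `J ∈ {J', J''}`: (a) `J` is orthogonal for the normal metric
`⟨X,Y⟩ = −½·trace(XY)` on `𝒽`, and (b) `J` commutes with `Ad(k)` for every
`k = diag(1, A, 1)`, `A ∈ SO(2)`. -/
theorem stmt12 :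
    ∀ J ∈ ({Jp, Jpp} : Set (Matrix (Fin 4) (Fin 4) ℝ → Matrix (Fin 4) (Fin 4) ℝ)),
      (∀ x2 x3 y2 y3 x2' x3' y2' y3' : ℝ,
          -(1 / 2 : ℝ) * (J (Hmat x2 x3 y2 y3) * J (Hmat x2' x3' y2' y3')).trace =
            -(1 / 2 : ℝ) * (Hmat x2 x3 y2 y3 * Hmat x2' x3' y2' y3').trace) ∧
      (∀ A : Matrix (Fin 2) (Fin 2) ℝ, Aᵀ * A = 1 → A.det = 1 →
        ∀ x2 x3 y2 y3 : ℝ,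
          kMat A * J (Hmat x2 x3 y2 y3) * (kMat A)⁻¹ =
            J (kMat A * Hmat x2 x3 y2 y3 * (kMat A)⁻¹)) := by
  rintro J (rfl | rfl)
  · refine ⟨fun x2 x3 y2 y3 x2' x3' y2' y3' => ?_, fun A hA hdet x2 x3 y2 y3 => ?_⟩
    · simp only [Jp_Hmat, trace_Hmat_mul_Hmat]
      ring
    · obtain ⟨h11, h01⟩ := entries_of_special_orthogonal hA hdet
      simp only [kMat_inv hA, Jp_Hmat, kMat_mul_Hmat_mul_kMat_transpose, h11, h01]
      congr 1 <;> ring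
  · refine ⟨fun x2 x3 y2 y3 x2' x3' y2' y3' => ?_, fun A hA hdet x2 x3 y2 y3 => ?_⟩
    · simp only [Jpp_Hmat, trace_Hmat_mul_Hmat]
      ring
    · obtain ⟨h11, h01⟩ := entries_of_special_orthogonal hA hdet
      simp only [kMat_inv hA, Jpp_Hmat, kMat_mul_Hmat_mul_kMat_transpose, h11, h01]
      congr 1 <;> ring
end
end

section
/- For all real numbers u, H and every complex number ξ, the commutator [A_𝔭, B_𝔭] = A_𝔭·B_𝔭 − B_𝔭·A_𝔭 lies in the complexification of 𝔨; that is, every entry of [A_𝔭, B_𝔭] vanishes except possibly the (2,3) and (3,2) entries (the 𝔭-component of [A_𝔭, B_𝔭] is zero). -/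
noncomputable section

open Matrix

/-- The matrix `A_𝔭` determined by `u, H ∈ ℝ` and `ξ ∈ ℂ`. -/
def Ap (u H : ℝ) (ξ : ℂ) : Matrix (Fin 4) (Fin 4) ℂ :=
  Matrix.of
    ![![0, -((Real.exp u : ℂ) / (Real.sqrt 2 : ℂ)),
        Complex.I * ((Real.exp u : ℂ) / (Real.sqrt 2 : ℂ)), 0],
      ![(Real.exp u : ℂ) / (Real.sqrt 2 : ℂ), 0, 0,
        ((Real.exp (-u) : ℂ) * ξ + (Real.exp u : ℂ) * (H : ℂ)) / (Real.sqrt 2 : ℂ)],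
      ![-(Complex.I * ((Real.exp u : ℂ) / (Real.sqrt 2 : ℂ))), 0, 0,
        Complex.I * (((Real.exp (-u) : ℂ) * ξ - (Real.exp u : ℂ) * (H : ℂ)) / (Real.sqrt 2 : ℂ))],
      ![0, ((Real.exp (-u) : ℂ) * ξ + (Real.exp u : ℂ) * (H : ℂ)) / (Real.sqrt 2 : ℂ),
        Complex.I * (((Real.exp (-u) : ℂ) * ξ - (Real.exp u : ℂ) * (H : ℂ)) / (Real.sqrt 2 : ℂ)),
        0]]

/-- The matrix `B_𝔭`: the entrywise complex conjugate of `A_𝔭`. -/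
def Bp (u H : ℝ) (ξ : ℂ) : Matrix (Fin 4) (Fin 4) ℂ := (Ap u H ξ).map (starRingEnd ℂ)

/-- The commutator `[A_𝔭, B_𝔭]` lies in the complexification of `𝔨`: every entry
vanishes except possibly the (2,3) and (3,2) entries (one-based), i.e. the
`𝔭`-component of `[A_𝔭, B_𝔭]` is zero. -/
theorem stmt14 (u H : ℝ) (ξ : ℂ) :
    ∀ i j : Fin 4, ¬(i = 1 ∧ j = 2) → ¬(i = 2 ∧ j = 1) →
      (Ap u H ξ * Bp u H ξ - Bp u H ξ * Ap u H ξ) i j = 0 := by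
  intro i j h₁₂ h₂₁
  simp only [Bp, Ap, Matrix.sub_apply, Matrix.mul_apply, Fin.sum_univ_four, Matrix.map_apply]
  fin_cases i <;> fin_cases j <;> simp at h₁₂ h₂₁ ⊢ <;>
    simp only [← Complex.ofReal_exp, ← Complex.ofReal_neg, Complex.conj_ofReal] <;>
    ring_nf <;> simp only [Complex.I_sq] <;> ring
end
end

section
/- Let U ⊆ ℂ be open and connected, and let u, H : U → ℝ and ξ : U → ℂ be smooth functions satisfying the Codazzi equation ξ_{z̄} = e^{2u}·H_z on U. Then the matrix equation ∂_{z̄}A_𝔭 + [B_𝔨, A_𝔭] = 0 holds identically on U (where ∂_{z̄} is applied entrywise and [X,Y] = XY − YX) if and only if H is constant on U. (This is the harmonic map equation for the twistor lift of a conformally immersed spacelike surface in De Sitter 3-space: the twistor lift is harmonic for the normal metric if and only if the surface has constant mean curvature.) -/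
noncomputable section

open Matrix

/-- Entrywise `∂_z` of a matrix-valued function on `ℂ`. -/
def mdz (M : ℂ → Matrix (Fin 4) (Fin 4) ℂ) (p : ℂ) : Matrix (Fin 4) (Fin 4) ℂ :=
  Matrix.of fun i j => dzS (fun q => M q i j) p

/-- Entrywise `∂_{z̄}` of a matrix-valued function on `ℂ`. -/
def mdzbar (M : ℂ → Matrix (Fin 4) (Fin 4) ℂ) (p : ℂ) : Matrix (Fin 4) (Fin 4) ℂ :=
  Matrix.of fun i j => dzbarS (fun q => M q i j) p

/-- The matrix-valued function `A_𝔨`: only nonzero entries are the (2,3) entry `i·u_z`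
and the (3,2) entry `−i·u_z` (one-based indexing). -/
def Ak (u : ℂ → ℝ) (p : ℂ) : Matrix (Fin 4) (Fin 4) ℂ :=
  Matrix.of
    ![![0, 0, 0, 0], ![0, 0, Complex.I * dzR u p, 0],
      ![0, -(Complex.I * dzR u p), 0, 0], ![0, 0, 0, 0]]

/-- The matrix-valued function `B_𝔨`: only nonzero entries are the (2,3) entry `−i·u_{z̄}`
and the (3,2) entry `i·u_{z̄}` (one-based indexing). -/
def Bk (u : ℂ → ℝ) (p : ℂ) : Matrix (Fin 4) (Fin 4) ℂ :=
  Matrix.of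
    ![![0, 0, 0, 0], ![0, 0, -(Complex.I * dzbarR u p), 0],
      ![0, Complex.I * dzbarR u p, 0, 0], ![0, 0, 0, 0]]

theorem dzbarS_const (c p : ℂ) : dzbarS (fun _ => c) p = 0 := by
  simp [dzbarS]

theorem dzbarS_neg (f : ℂ → ℂ) (p : ℂ) : dzbarS (fun q => -f q) p = -dzbarS f p := by
  have h : fderiv ℝ (fun q => -f q) p = -fderiv ℝ f p := fderiv_fun_neg
  simp only [dzbarS, h, _root_.neg_apply]
  ring

theorem dzbarS_add {f g : ℂ → ℂ} {p : ℂ} (hf : DifferentiableAt ℝ f p)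
    (hg : DifferentiableAt ℝ g p) :
    dzbarS (fun q => f q + g q) p = dzbarS f p + dzbarS g p := by
  simp only [dzbarS, fderiv_fun_add hf hg, _root_.add_apply]
  ring

theorem dzbarS_sub {f g : ℂ → ℂ} {p : ℂ} (hf : DifferentiableAt ℝ f p)
    (hg : DifferentiableAt ℝ g p) :
    dzbarS (fun q => f q - g q) p = dzbarS f p - dzbarS g p := by
  simp only [dzbarS, fderiv_fun_sub hf hg, _root_.sub_apply]
  ring

theorem dzbarS_mul {f g : ℂ → ℂ} {p : ℂ} (hf : DifferentiableAt ℝ f p)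
    (hg : DifferentiableAt ℝ g p) :
    dzbarS (fun q => f q * g q) p = f p * dzbarS g p + dzbarS f p * g p := by
  simp only [dzbarS, fderiv_fun_mul hf hg, _root_.add_apply,
    _root_.smul_apply, smul_eq_mul]
  ring

theorem dzbarS_const_mul {f : ℂ → ℂ} {p : ℂ} (hf : DifferentiableAt ℝ f p) (c : ℂ) :
    dzbarS (fun q => c * f q) p = c * dzbarS f p := by
  rw [dzbarS_mul (differentiableAt_const c) hf, dzbarS_const]
  ring

theorem dzbarS_div_const {f : ℂ → ℂ} {p : ℂ} (hf : DifferentiableAt ℝ f p) (c : ℂ) :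
    dzbarS (fun q => f q / c) p = dzbarS f p / c := by
  simp only [div_eq_inv_mul]
  exact dzbarS_const_mul hf _

theorem DifferentiableAt.complex_ofReal_comp {f : ℂ → ℝ} {p : ℂ} (hf : DifferentiableAt ℝ f p) :
    DifferentiableAt ℝ (fun q => (f q : ℂ)) p :=
  Complex.ofRealCLM.differentiableAt.comp p hf

theorem dzbarS_ofReal {f : ℂ → ℝ} {p : ℂ} (hf : DifferentiableAt ℝ f p) :
    dzbarS (fun q => (f q : ℂ)) p = dzbarR f p := by
  have h : fderiv ℝ (fun q => (f q : ℂ)) p = Complex.ofRealCLM.comp (fderiv ℝ f p) :=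
    (Complex.ofRealCLM.hasFDerivAt.comp p hf.hasFDerivAt).fderiv
  simp [dzbarS, dzbarR, h]

theorem dzbarR_exp {f : ℂ → ℝ} {p : ℂ} (hf : DifferentiableAt ℝ f p) :
    dzbarR (fun q => Real.exp (f q)) p = (Real.exp (f p) : ℂ) * dzbarR f p := by
  simp only [dzbarR, fderiv_exp hf, _root_.smul_apply, smul_eq_mul,
    Complex.ofReal_mul]
  ring

theorem dzbarR_neg (f : ℂ → ℝ) (p : ℂ) : dzbarR (fun q => -f q) p = -dzbarR f p := by
  have h : fderiv ℝ (fun q => -f q) p = -fderiv ℝ f p := fderiv_fun_neg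
  simp only [dzbarR, h, _root_.neg_apply, Complex.ofReal_neg]
  ring

/-- Under the Codazzi equation, the left-hand side of the harmonic map equation only involves
the partial derivatives of `H`. -/
theorem mdzbar_Ap_add_commutator {u H : ℂ → ℝ} {ξ : ℂ → ℂ} {p : ℂ}
    (hu : DifferentiableAt ℝ u p) (hH : DifferentiableAt ℝ H p) (hξ : DifferentiableAt ℝ ξ p)
    (hcodazzi : dzbarS ξ p = (Real.exp (2 * u p) : ℂ) * dzR H p) :
    mdzbar (fun q => Ap (u q) (H q) (ξ q)) p
        + (Bk u p * Ap (u p) (H p) (ξ p) - Ap (u p) (H p) (ξ p) * Bk u p) =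
      ((Real.exp (u p) : ℂ) / (Real.sqrt 2 : ℂ)) •
        !![0, 0, 0, 0;
          0, 0, 0, (fderiv ℝ H p 1 : ℂ);
          0, 0, 0, (fderiv ℝ H p Complex.I : ℂ);
          0, (fderiv ℝ H p 1 : ℂ), (fderiv ℝ H p Complex.I : ℂ), 0] := by
  have dE := hu.exp.complex_ofReal_comp
  have dE' := hu.fun_neg.exp.complex_ofReal_comp
  have dH := hH.complex_ofReal_comp
  have hE := (dzbarS_ofReal hu.exp).trans (dzbarR_exp hu)
  have hE' := (dzbarS_ofReal hu.fun_neg.exp).trans (dzbarR_exp hu.fun_neg)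
  rw [dzbarR_neg] at hE'
  have dP := dE'.fun_mul hξ
  have dQ := dE.fun_mul dH
  have hP := dzbarS_mul dE' hξ
  have hQ := dzbarS_mul dE dH
  rw [hE', hcodazzi] at hP
  rw [hE, dzbarS_ofReal hH] at hQ
  have hexp : (Real.exp (-u p) : ℂ) * (Real.exp (2 * u p) : ℂ) = (Real.exp (u p) : ℂ) := by
    rw [← Complex.ofReal_mul, ← Real.exp_add]
    congr 2
    ring
  have hs : dzbarS (fun q => ((Real.exp (-u q) : ℂ) * ξ q + (Real.exp (u q) : ℂ) * (H q : ℂ))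
        / (Real.sqrt 2 : ℂ)) p =
      ((Real.exp (u p) : ℂ) * fderiv ℝ H p 1 - dzbarR u p * ((Real.exp (-u p) : ℂ) * ξ p
        - (Real.exp (u p) : ℂ) * (H p : ℂ))) / (Real.sqrt 2 : ℂ) := by
    rw [dzbarS_div_const (dP.fun_add dQ), dzbarS_add dP dQ, hP, hQ, ← mul_assoc, hexp]
    simp only [dzR, dzbarR]
    ring
  have hd : dzbarS (fun q => Complex.I * (((Real.exp (-u q) : ℂ) * ξ q
        - (Real.exp (u q) : ℂ) * (H q : ℂ)) / (Real.sqrt 2 : ℂ))) p =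
      ((Real.exp (u p) : ℂ) * fderiv ℝ H p Complex.I
        - Complex.I * dzbarR u p * ((Real.exp (-u p) : ℂ) * ξ p
        + (Real.exp (u p) : ℂ) * (H p : ℂ))) / (Real.sqrt 2 : ℂ) := by
    rw [dzbarS_const_mul ((dP.fun_sub dQ).mul_const _ : DifferentiableAt ℝ (fun q => _ / _) p),
      dzbarS_div_const (dP.fun_sub dQ), dzbarS_sub dP dQ, hP, hQ, ← mul_assoc, hexp]
    simp only [dzR, dzbarR]
    linear_combination (-(Real.exp (u p) : ℂ) * fderiv ℝ H p Complex.I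
      / (Real.sqrt 2 : ℂ)) * Complex.I_sq
  have hr : dzbarS (fun q => (Real.exp (u q) : ℂ) / (Real.sqrt 2 : ℂ)) p =
      (Real.exp (u p) : ℂ) * dzbarR u p / (Real.sqrt 2 : ℂ) := by
    rw [dzbarS_div_const dE, hE]
  have hi : dzbarS (fun q => Complex.I * ((Real.exp (u q) : ℂ) / (Real.sqrt 2 : ℂ))) p =
      Complex.I * ((Real.exp (u p) : ℂ) * dzbarR u p / (Real.sqrt 2 : ℂ)) := by
    rw [dzbarS_const_mul (dE.mul_const _ : DifferentiableAt ℝ (fun q => _ / _) p), hr]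
  have hA : mdzbar (fun q => Ap (u q) (H q) (ξ q)) p = Matrix.of fun i j =>
      dzbarS (fun q => Ap (u q) (H q) (ξ q) i j) p := rfl
  rw [hA]
  ext i j
  fin_cases i <;> fin_cases j <;>
    simp [-Complex.ofReal_exp, Ap, Bk, dzbarS_const,
      dzbarS_neg, hs, hd, hr, hi] <;>
    ring_nf <;> simp only [Complex.I_sq] <;> ring

/-- Harmonic map equation for the twistor lift: given smooth data `u, H, ξ` on a
connected open `U` satisfying the Codazzi equation `ξ_{z̄} = e^{2u} H_z`, the matrix
equation `∂_{z̄}A_𝔭 + [B_𝔨, A_𝔭] = 0` holds on `U` iff `H` is constant on `U`. -/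
theorem stmt15 (U : Set ℂ) (hU : IsOpen U) (hconn : IsConnected U)
    (u H : ℂ → ℝ) (ξ : ℂ → ℂ)
    (hu : ContDiffOn ℝ (⊤ : ℕ∞) u U) (hH : ContDiffOn ℝ (⊤ : ℕ∞) H U)
    (hxi : ContDiffOn ℝ (⊤ : ℕ∞) ξ U)
    (hcodazzi : ∀ p ∈ U, dzbarS ξ p = (Real.exp (2 * u p) : ℂ) * dzR H p) :
    (∀ p ∈ U,
        mdzbar (fun q => Ap (u q) (H q) (ξ q)) p
          + (Bk u p * Ap (u p) (H p) (ξ p) - Ap (u p) (H p) (ξ p) * Bk u p) = 0) ↔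
      (∀ p ∈ U, ∀ q ∈ U, H p = H q) := by
  have hfd : ∀ {F : Type} [NormedAddCommGroup F] [NormedSpace ℝ F] {f : ℂ → F},
      ContDiffOn ℝ (⊤ : ℕ∞) f U → ∀ p ∈ U, DifferentiableAt ℝ f p := fun hf p hp =>
    (hf.contDiffAt (hU.mem_nhds hp)).differentiableAt (by simp)
  have key := fun p hp => mdzbar_Ap_add_commutator (hfd hu p hp) (hfd hH p hp) (hfd hxi p hp)
    (hcodazzi p hp)
  constructor
  · intro h
    have hzero : ∀ p ∈ U, fderiv ℝ H p = 0 := by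
      intro p hp
      have hm := (key p hp).symm.trans (h p hp)
      have h1 := congrFun (congrFun hm 1) 3
      have h2 := congrFun (congrFun hm 2) 3
      simp [-Complex.ofReal_exp] at h1 h2
      ext v
      have hv : v = v.re • (1 : ℂ) + v.im • Complex.I := by
        simp
      rw [hv, map_add, map_smul, map_smul, h1, h2]
      simp
    intro p hp q hq
    exact hU.is_const_of_fderiv_eq_zero hconn.isPreconnected
      (fun x hx => (hfd hH x hx).differentiableWithinAt) hzero hp hq
  · intro h p hp
    have hz : fderiv ℝ H p = 0 := by
      have he : H =ᶠ[nhds p] fun _ => H p := by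
        filter_upwards [hU.mem_nhds hp] with q hq using h q hq p hp
      rw [he.fderiv_eq, fderiv_fun_const]
      rfl
    rw [key p hp, hz]
    ext i j
    fin_cases i <;> fin_cases j <;> simp
end
end

section
/- For all real numbers u, H and every complex number ξ, let A_𝔭 be the associated matrix, which lies in the complexification of 𝒽, and let J'_ℂ and J''_ℂ be the complex-linear extensions of J' and J''. Then: (i) J'_ℂ(A_𝔭) = i·A_𝔭 if and only if ξ = 0; (ii) J''_ℂ(A_𝔭) = i·A_𝔭 if and only if H = 0; and (iii) −½·trace(A_𝔭·A_𝔭) = −2·ξ·H, so A_𝔭 is isotropic for the complex-bilinear extension of the normal metric if and only if ξ·H = 0. (Geometrically: the twistor lift of a spacelike surface is J'-holomorphic iff the surface is totally umbilic, J''-holomorphic iff it is maximal, and conformal iff ξH = 0.) -/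
noncomputable section

open Matrix

/-- The general element of the complexification of `𝒽`, with parameters
`(x₂, x₃, y₂, y₃) ∈ ℂ⁴`. -/
def HmatC (x2 x3 y2 y3 : ℂ) : Matrix (Fin 4) (Fin 4) ℂ :=
  Matrix.of ![![0, x2, x3, 0], ![-x2, 0, 0, y2], ![-x3, 0, 0, y3], ![0, y2, y3, 0]]

/-- Complex-linear extension of `J'`: `(x₂,x₃,y₂,y₃) ↦ (−x₃,x₂,−y₃,y₂)` (read off the
parameters from the matrix entries). -/
def JpC (X : Matrix (Fin 4) (Fin 4) ℂ) : Matrix (Fin 4) (Fin 4) ℂ :=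
  HmatC (-(X 0 2)) (X 0 1) (-(X 2 3)) (X 1 3)

/-- Complex-linear extension of `J''`: `(x₂,x₃,y₂,y₃) ↦ (−x₃,x₂,y₃,−y₂)`. -/
def JppC (X : Matrix (Fin 4) (Fin 4) ℂ) : Matrix (Fin 4) (Fin 4) ℂ :=
  HmatC (-(X 0 2)) (X 0 1) (X 2 3) (-(X 1 3))

theorem HmatC_inj {x2 x3 y2 y3 x2' x3' y2' y3' : ℂ} :
    HmatC x2 x3 y2 y3 = HmatC x2' x3' y2' y3' ↔ x2 = x2' ∧ x3 = x3' ∧ y2 = y2' ∧ y3 = y3' := by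
  constructor
  · intro h
    have entry (i j : Fin 4) := congrFun (congrFun h i) j
    exact ⟨entry 0 1, entry 0 2, entry 1 3, entry 2 3⟩
  · rintro ⟨rfl, rfl, rfl, rfl⟩
    rfl

theorem smul_HmatC (c x2 x3 y2 y3 : ℂ) :
    c • HmatC x2 x3 y2 y3 = HmatC (c * x2) (c * x3) (c * y2) (c * y3) := by
  ext i j
  fin_cases i <;> fin_cases j <;> simp [HmatC]

theorem JpC_HmatC (x2 x3 y2 y3 : ℂ) : JpC (HmatC x2 x3 y2 y3) = HmatC (-x3) x2 (-y3) y2 := rfl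

theorem JppC_HmatC (x2 x3 y2 y3 : ℂ) : JppC (HmatC x2 x3 y2 y3) = HmatC (-x3) x2 y3 (-y2) := rfl

theorem trace_HmatC_mul_self (x2 x3 y2 y3 : ℂ) :
    (HmatC x2 x3 y2 y3 * HmatC x2 x3 y2 y3).trace
      = 2 * (y2 ^ 2 + y3 ^ 2 - x2 ^ 2 - x3 ^ 2) := by
  simp [HmatC, Matrix.trace, Fin.sum_univ_four]
  ring

/-- `A_𝔭` in the coordinates `(x₂, x₃, y₂, y₃)`, with `a = eᵘ/√2`, `p = e⁻ᵘξ/√2` and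
`q = eᵘH/√2`. -/
theorem exists_Ap_eq_HmatC (u H : ℝ) (ξ : ℂ) :
    ∃ a p q : ℂ, Ap u H ξ = HmatC (-a) (Complex.I * a) (p + q) (Complex.I * (p - q)) ∧
      (p = 0 ↔ ξ = 0) ∧ (q = 0 ↔ H = 0) ∧ 2 * (p * q) = ξ * H := by
  have hs : (Real.sqrt 2 : ℂ) ≠ 0 := by simp
  have hs2 : (Real.sqrt 2 : ℂ) ^ 2 = 2 := by
    exact_mod_cast Real.sq_sqrt (zero_le_two (α := ℝ))
  have he : (Real.exp (-u) : ℂ) * (Real.exp u : ℂ) = 1 := by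
    rw [← Complex.ofReal_mul, ← Real.exp_add]
    simp
  refine ⟨Real.exp u / Real.sqrt 2, Real.exp (-u) * ξ / Real.sqrt 2,
    Real.exp u * H / Real.sqrt 2, ?_, by simp, by simp, ?_⟩
  · rw [← add_div, ← sub_div]
    simp only [Ap, HmatC, neg_neg]
  · field_simp
    rw [hs2]
    linear_combination 2 * ξ * (H : ℂ) * he

/-- (i) `J'(A_𝔭) = i A_𝔭` iff `ξ = 0` (totally umbilic); (ii) `J''(A_𝔭) = i A_𝔭` iff
`H = 0` (maximal); (iii) `−½ trace(A_𝔭²) = −2ξH`, so `A_𝔭` is isotropic iff `ξH = 0`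
(the twistor lift is conformal iff `ξH = 0`). -/
theorem stmt18 (u H : ℝ) (ξ : ℂ) :
    (JpC (Ap u H ξ) = Complex.I • Ap u H ξ ↔ ξ = 0) ∧
    (JppC (Ap u H ξ) = Complex.I • Ap u H ξ ↔ H = 0) ∧
    (-(1 / 2 : ℂ) * (Ap u H ξ * Ap u H ξ).trace = -2 * ξ * (H : ℂ)) ∧
    (-(1 / 2 : ℂ) * (Ap u H ξ * Ap u H ξ).trace = 0 ↔ ξ * (H : ℂ) = 0) := by
  obtain ⟨a, p, q, hA, hp, hq, hpq⟩ := exists_Ap_eq_HmatC u H ξ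
  have hI := Complex.I_sq
  have htrace : -(1 / 2 : ℂ) * (Ap u H ξ * Ap u H ξ).trace = -2 * ξ * (H : ℂ) := by
    rw [hA, trace_HmatC_mul_self]
    linear_combination (a ^ 2 - (p - q) ^ 2) * hI - 2 * hpq
  refine ⟨?_, ?_, htrace, ?_⟩
  · rw [hA, JpC_HmatC, smul_HmatC, HmatC_inj, ← hp]
    constructor
    · rintro ⟨-, -, -, h⟩
      linear_combination h / 2 + (p - q) / 2 * hI
    · rintro rfl
      refine ⟨by ring, ?_, by ring, ?_⟩
      · linear_combination -a * hI
      · linear_combination q * hI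
  · rw [hA, JppC_HmatC, smul_HmatC, HmatC_inj, ← hq]
    constructor
    · rintro ⟨-, -, -, h⟩
      linear_combination -h / 2 - (p - q) / 2 * hI
    · rintro rfl
      refine ⟨by ring, ?_, by ring, ?_⟩
      · linear_combination -a * hI
      · linear_combination -p * hI
  · rw [htrace, mul_assoc]
    simp
end
end

section
/- For all real numbers u, H and every complex number ξ, the following trace identity holds: −½·trace(A_𝔭·B_𝔭) = e^{2u}(1 − H²) − e^{−2u}|ξ|². (This computes the energy density of the twistor lift with respect to the normal metric: ½‖d f̂‖² = e^{−2u}·⟨f̂_z, f̂_{z̄}⟩ = 1 − H² − e^{−4u}|ξ|².) -/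
noncomputable section

open Matrix

/-- Energy density of the twistor lift:
`−½·trace(A_𝔭·B_𝔭) = e^{2u}(1 − H²) − e^{−2u}|ξ|²`. -/
theorem stmt19 (u H : ℝ) (ξ : ℂ) :
    -(1 / 2 : ℂ) * (Ap u H ξ * Bp u H ξ).trace =
      ((Real.exp (2 * u) * (1 - H ^ 2) - Real.exp (-(2 * u)) * Complex.normSq ξ : ℝ) : ℂ) := by
  have h2 : ((Real.sqrt 2 : ℝ) : ℂ) ^ 2 = 2 := by
    rw [← Complex.ofReal_pow, Real.sq_sqrt zero_le_two, Complex.ofReal_ofNat]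
  have h0 : ((Real.sqrt 2 : ℝ) : ℂ) ≠ 0 := by
    intro h
    simp [h] at h2
  have e1 : Real.exp (2 * u) = Real.exp u ^ 2 := by
    rw [← Real.exp_nat_mul, Nat.cast_ofNat]
  have e2 : Real.exp (-(2 * u)) = Real.exp (-u) ^ 2 := by
    rw [← Real.exp_nat_mul, Nat.cast_ofNat, mul_neg]
  rw [e1, e2]
  simp only [Complex.ofReal_sub, Complex.ofReal_mul, Complex.ofReal_pow, Complex.ofReal_one]
  rw [← Complex.mul_conj]
  simp only [Matrix.trace, Matrix.diag, Matrix.mul_apply, Fin.sum_univ_four, Ap, Bp,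
    Matrix.map_apply, Matrix.of_apply, Matrix.cons_val, map_zero, map_neg, map_mul, map_div₀,
    map_add, map_sub, Complex.conj_ofReal, Complex.conj_I]
  generalize ((Real.exp u : ℝ) : ℂ) = a
  generalize ((Real.exp (-u) : ℝ) : ℂ) = b
  generalize ((Real.sqrt 2 : ℝ) : ℂ) = s at *
  generalize (starRingEnd ℂ) ξ = η
  field_simp
  ring_nf
  simp only [h2, Complex.I_sq]
  ring
end
end
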